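/- arXiv:1411.2116 — 3 statements merged into one kernel-verified Lean document; each statement's English description precedes it below -/
import Mathlib

section
/- If b ≠ 0, then a real number λ is an eigenvalue of A if and only if λ = a + 2b·cos(ℓπ/(m+1)) for some ℓ ∈ {1,…,m}; that is, the spectrum of A is exactly {λ_1,…,λ_m}. -/
/-- The `m × m` tridiagonal symmetric Toeplitz matrix with `a` on the diagonal
and `b` on the sub/super-diagonals (`0`-based indices). -/
noncomputable def triToeplitz (m : ℕ) (a b : ℝ) : Matrix (Fin m) (Fin m) ℝ :=
  Matrix.of fun i j : Fin m =>
    if i = j then a else if i.1 + 1 = j.1 ∨ j.1 + 1 = i.1 then b else 0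

/-- `λ_ℓ = a + 2 b cos(ℓ π/(m+1))`, where `ℓ : Fin m` corresponds to the
`1`-based index `ℓ.1 + 1`. -/
noncomputable def eigVal (m : ℕ) (a b : ℝ) (ℓ : Fin m) : ℝ :=
  a + 2 * b * Real.cos ((ℓ.1 + 1) * Real.pi / (m + 1))

theorem triToeplitz_mulVec {m : ℕ} (a b : ℝ) {f : ℕ → ℝ} (h0 : f 0 = 0) (hm : f (m + 1) = 0)
    (i : Fin m) :
    (triToeplitz m a b).mulVec (fun j => f (j + 1)) i =
      a * f (i + 1) + b * (f i + f (i + 2)) := by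
  obtain ⟨i, hi⟩ := i
  have entry (j : Fin m) : triToeplitz m a b ⟨i, hi⟩ j * f (j + 1) =
      (if i = (j : ℕ) then a * f (j + 1) else 0) +
        (if i + 1 = (j : ℕ) then b * f (j + 1) else 0) +
        (if i = (j : ℕ) + 1 then b * f (j + 1) else 0) := by
    simp only [triToeplitz, Matrix.of_apply, Fin.ext_iff]
    split_ifs <;> first | omega | simp
  have above : (if i + 1 < m then b * f (i + 2) else 0) = b * f (i + 2) := by
    split_ifs with h
    · rfl
    · rw [show i + 2 = m + 1 by omega, hm, mul_zero]
  have below : ∑ j ∈ Finset.range m, (if i = j + 1 then b * f (j + 1) else 0) = b * f i := by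
    cases i with
    | zero => simp [h0]
    | succ k => simp [show k < m by omega]
  simp only [Matrix.mulVec, dotProduct, entry]
  rw [Fin.sum_univ_eq_sum_range (fun j => (if i = j then a * f (j + 1) else 0) +
    (if i + 1 = j then b * f (j + 1) else 0) + (if i = j + 1 then b * f (j + 1) else 0)) m,
    Finset.sum_add_distrib, Finset.sum_add_distrib, below]
  simp only [Finset.sum_ite_eq, Finset.mem_range, hi, if_true, above]
  ring

theorem angle_mem_Ioo {m : ℕ} (ℓ : Fin m) :
    ((ℓ.1 : ℝ) + 1) * Real.pi / (m + 1) ∈ Set.Ioo 0 Real.pi := by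
  have hℓ : (ℓ.1 : ℝ) + 1 ≤ m := by exact_mod_cast ℓ.2
  refine ⟨by positivity, ?_⟩
  rw [div_lt_iff₀ (by positivity)]
  nlinarith [Real.pi_pos]

theorem eigVal_injective (m : ℕ) (a : ℝ) {b : ℝ} (hb : b ≠ 0) :
    Function.Injective (eigVal m a b) := by
  intro k ℓ h
  have hcos : Real.cos ((k.1 + 1) * Real.pi / (m + 1)) =
      Real.cos ((ℓ.1 + 1) * Real.pi / (m + 1)) := by
    simpa [eigVal, hb] using h
  have hangle := Real.injOn_cos (Set.Ioo_subset_Icc_self (angle_mem_Ioo k))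
    (Set.Ioo_subset_Icc_self (angle_mem_Ioo ℓ)) hcos
  have hm : (m : ℝ) + 1 ≠ 0 := by positivity
  rw [div_left_inj' hm, mul_left_inj' Real.pi_ne_zero, add_left_inj, Nat.cast_inj] at hangle
  exact Fin.ext hangle

theorem hasEigenvalue_eigVal (m : ℕ) (a b : ℝ) (ℓ : Fin m) :
    Module.End.HasEigenvalue (Matrix.toLin' (triToeplitz m a b)) (eigVal m a b ℓ) := by
  set θ : ℝ := (ℓ.1 + 1) * Real.pi / (m + 1) with hθ
  have hend : Real.sin (((m + 1 : ℕ) : ℝ) * θ) = 0 := by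
    have : ((m + 1 : ℕ) : ℝ) * θ = ((ℓ.1 + 1 : ℕ) : ℝ) * Real.pi := by
      rw [hθ]; push_cast; field_simp
    rw [this, Real.sin_nat_mul_pi]
  refine Module.End.hasEigenvalue_of_hasEigenvector
    (x := fun j : Fin m => Real.sin (((j + 1 : ℕ) : ℝ) * θ))
    (Module.End.hasEigenvector_iff.mpr ⟨Module.End.mem_eigenspace_iff.mpr ?_, fun h => ?_⟩)
  · ext i
    rw [Matrix.toLin'_apply,
      triToeplitz_mulVec a b (f := fun n => Real.sin ((n : ℝ) * θ)) (by simp) hend]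
    have hl : (i : ℝ) * θ = (i + 1) * θ - θ := by ring
    have hr : ((i : ℝ) + 2) * θ = (i + 1) * θ + θ := by ring
    simp only [Pi.smul_apply, smul_eq_mul, eigVal, ← hθ]
    push_cast
    rw [hl, hr, Real.sin_sub, Real.sin_add]
    ring
  · have hfirst := congrFun h ⟨0, ℓ.pos⟩
    have hpos := Real.sin_pos_of_mem_Ioo (angle_mem_Ioo ℓ)
    simp only [zero_add, Nat.cast_one, one_mul, Pi.zero_apply] at hfirst
    exact hpos.ne' hfirst

theorem stmt1 (m : ℕ) (hm : 2 ≤ m) (a b : ℝ) (hb : b ≠ 0) (μ : ℝ) :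
    Module.End.HasEigenvalue (Matrix.toLin' (triToeplitz m a b)) μ ↔
      ∃ ℓ : Fin m, μ = eigVal m a b ℓ := by
  refine ⟨fun hμ => ?_, ?_⟩
  · by_contra! hne
    let ν : Option (Fin m) → ℝ := fun o => o.elim μ (eigVal m a b)
    have hν : Function.Injective ν := by
      rintro (_ | k) (_ | ℓ) h
      · rfl
      · exact absurd h (hne ℓ)
      · exact absurd h.symm (hne k)
      · exact congrArg some (eigVal_injective m a hb h)
    have hvec (o : Option (Fin m)) :
        ∃ v, Module.End.HasEigenvector (Matrix.toLin' (triToeplitz m a b)) (ν o) v := by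
      cases o with
      | none => exact hμ.exists_hasEigenvector
      | some ℓ => exact (hasEigenvalue_eigVal m a b ℓ).exists_hasEigenvector
    choose v hv using hvec
    have hcard := (Module.End.eigenvectors_linearIndependent' _ ν hν v hv).fintype_card_le_finrank
    simp at hcard
  · rintro ⟨ℓ, rfl⟩
    exact hasEigenvalue_eigVal m a b ℓ
end

section
/- If a > 0, b > 0, and 2b·cos(π/(m+1)) < a, then the tridiagonal symmetric Toeplitz matrix A is positive definite, i.e., xᵀAx > 0 for every nonzero x ∈ ℝ^m. -/
/-- The quadratic form of a tridiagonal Toeplitz matrix, as sums over ranges. -/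
theorem sum_sum_tridiagonal (a b : ℝ) (y : ℕ → ℝ) (n : ℕ) :
    ∑ i ∈ Finset.range (n + 1), ∑ j ∈ Finset.range (n + 1),
        y i * ((if i = j then a else if i + 1 = j ∨ j + 1 = i then b else 0) * y j) =
      a * ∑ k ∈ Finset.range (n + 1), y k ^ 2 +
        b * ∑ k ∈ Finset.range n, 2 * y k * y (k + 1) := by
  induction n with
  | zero => simp; ring
  | succ n ih =>
    have hrow : ∑ j ∈ Finset.range (n + 1),
        y (n + 1) * ((if n + 1 = j then a else if n + 1 + 1 = j ∨ j + 1 = n + 1 then b else 0)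
          * y j) = b * y n * y (n + 1) := by
      rw [Finset.sum_eq_single_of_mem n (by simp)]
      · simp; ring
      · intro j hj hjn
        rw [Finset.mem_range] at hj
        rw [if_neg (by lia), if_neg (by lia)]
        ring
    have hcol : ∑ i ∈ Finset.range (n + 1),
        y i * ((if i = n + 1 then a else if i + 1 = n + 1 ∨ n + 1 + 1 = i then b else 0)
          * y (n + 1)) = b * y n * y (n + 1) := by
      rw [Finset.sum_eq_single_of_mem n (by simp)]
      · simp; ring
      · intro i hi hin
        rw [Finset.mem_range] at hi
        rw [if_neg (by lia), if_neg (by lia)]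
        ring
    rw [Finset.sum_range_succ]
    simp_rw [Finset.sum_range_succ _ (n + 1)]
    rw [Finset.sum_add_distrib, ih, hrow, hcol,
      Finset.sum_range_succ (fun k => 2 * y k * y (k + 1)) n,
      if_pos trivial]
    ring

/-- A discrete Picone-type inequality with weights `sin ((k + 1) θ)`. -/
theorem neg_sum_mul_succ_add_le (θ : ℝ) (y : ℕ → ℝ) (n : ℕ)
    (hs : ∀ k ≤ n, 0 < Real.sin ((k + 1) * θ)) :
    -∑ k ∈ Finset.range n, 2 * y k * y (k + 1) +
        y n ^ 2 * (Real.sin ((n + 2) * θ) / Real.sin ((n + 1) * θ)) ≤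
      2 * Real.cos θ * ∑ k ∈ Finset.range (n + 1), y k ^ 2 := by
  induction n with
  | zero =>
    have h := hs 0 le_rfl
    simp only [Nat.cast_zero, zero_add, one_mul] at h
    simp only [Finset.range_zero, Finset.sum_empty, Nat.cast_zero, zero_add, one_mul,
      Finset.sum_range_one, Real.sin_two_mul]
    apply le_of_eq
    field_simp
    ring
  | succ n ih =>
    have ih := ih fun k hk => hs k (by lia)
    have hp := hs n (by lia)
    have hq := hs (n + 1) le_rfl
    push_cast at hq ⊢
    rw [show (n : ℝ) + 1 + 1 = n + 2 by ring] at hq ⊢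
    have hrec : Real.sin ((n + 1 + 2) * θ) =
        2 * Real.cos θ * Real.sin ((n + 2) * θ) - Real.sin ((n + 1) * θ) := by
      rw [show ((n : ℝ) + 1 + 2) * θ = (n + 2) * θ + θ by ring,
        show ((n : ℝ) + 1) * θ = (n + 2) * θ - θ by ring, Real.sin_add, Real.sin_sub]
      ring
    rw [hrec, Finset.sum_range_succ, Finset.sum_range_succ _ (n + 1)]
    generalize Real.sin ((n + 1) * θ) = p at *
    generalize Real.sin ((n + 2) * θ) = q at *
    have hsq : 0 ≤ y n ^ 2 * (q / p) + 2 * y n * y (n + 1) + y (n + 1) ^ 2 * (p / q) := by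
      have : y n ^ 2 * (q / p) + 2 * y n * y (n + 1) + y (n + 1) ^ 2 * (p / q) =
          (y n * q + y (n + 1) * p) ^ 2 / (p * q) := by
        field_simp
        ring
      rw [this]
      positivity
    have hdiv : (2 * Real.cos θ * q - p) / q = 2 * Real.cos θ - p / q := by
      field_simp
    rw [hdiv]
    linarith

/-- The lower bound for the path-graph quadratic form. -/
theorem neg_sum_mul_succ_le_cos (y : ℕ → ℝ) (n : ℕ) :
    -∑ k ∈ Finset.range n, 2 * y k * y (k + 1) ≤
      2 * Real.cos (Real.pi / (n + 2)) * ∑ k ∈ Finset.range (n + 1), y k ^ 2 := by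
  have h := neg_sum_mul_succ_add_le (Real.pi / (n + 2)) y n fun k hk => by
    have hk' : (k : ℝ) ≤ n := by exact_mod_cast hk
    apply Real.sin_pos_of_pos_of_lt_pi
    · positivity
    · rw [← mul_div_assoc, div_lt_iff₀ (by positivity)]
      nlinarith [Real.pi_pos]
  rw [mul_div_cancel₀ _ (by positivity : (n : ℝ) + 2 ≠ 0), Real.sin_pi] at h
  simpa using h

theorem stmt4 (m : ℕ) (hm : 2 ≤ m) (a b : ℝ) (ha : 0 < a) (hb : 0 < b)
    (hab : 2 * b * Real.cos (Real.pi / (m + 1)) < a) :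
    (triToeplitz m a b).PosDef := by
  obtain ⟨n, rfl⟩ : ∃ n, m = n + 1 := ⟨m - 1, by lia⟩
  apply Matrix.PosDef.of_dotProduct_mulVec_pos
  · ext i j
    simp only [triToeplitz, Matrix.conjTranspose_apply, Matrix.of_apply, star_trivial,
      eq_comm (a := i), or_comm]
  · intro x hx
    let y : ℕ → ℝ := fun k => if h : k < n + 1 then x ⟨k, h⟩ else 0
    have hy (i : Fin (n + 1)) : x i = y i := by simp only [y, i.isLt, dite_true, Fin.eta]
    have hform : dotProduct (star x) ((triToeplitz (n + 1) a b).mulVec x) =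
        a * ∑ k ∈ Finset.range (n + 1), y k ^ 2 +
          b * ∑ k ∈ Finset.range n, 2 * y k * y (k + 1) := by
      rw [← sum_sum_tridiagonal]
      simp only [dotProduct, Matrix.mulVec, triToeplitz, Matrix.of_apply, Finset.sum_range,
        Finset.mul_sum, star_trivial, hy, Fin.ext_iff, Pi.star_apply]
    have hpos : 0 < ∑ k ∈ Finset.range (n + 1), y k ^ 2 := by
      obtain ⟨i, hi⟩ := Function.ne_iff.mp hx
      rw [hy, Pi.zero_apply] at hi
      exact Finset.sum_pos' (fun k _ => sq_nonneg _)
        ⟨i, Finset.mem_range.mpr i.isLt, by positivity⟩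
    have hle := mul_le_mul_of_nonneg_left (neg_sum_mul_succ_le_cos y n) hb.le
    push_cast at hab
    rw [show (n : ℝ) + 1 + 1 = n + 2 by ring] at hab
    have hlt := mul_lt_mul_of_pos_right hab hpos
    rw [hform]
    linarith
end

section
/- Let Q be a real polynomial in m variables that is homogeneous of degree n and has a strictly positive coefficient on every monomial of total degree n, and let P be a real polynomial in m variables of total degree at most n − 1. Then the function P − Q is bounded above on the closed nonnegative orthant [0,∞)^m, and (P − Q)(w) → −∞ as w_1 + … + w_m → +∞ with w in [0,∞)^m. -/
open MvPolynomial in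
/-- On the nonnegative orthant a real polynomial is bounded by a multiple of
`(1 + ∑ i, w i) ^ k` as soon as its total degree is at most `k`. -/
theorem MvPolynomial.eval_le_sum_abs_coeff_mul {σ : Type*} [Fintype σ] {k : ℕ}
    {p : MvPolynomial σ ℝ} (hp : p.totalDegree ≤ k) {w : σ → ℝ} (hw : ∀ i, 0 ≤ w i) :
    eval w p ≤ (∑ d ∈ p.support, |p.coeff d|) * (1 + ∑ i, w i) ^ k := by
  have hs : 0 ≤ ∑ i, w i := Finset.sum_nonneg fun i _ => hw i
  rw [eval_eq', Finset.sum_mul]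
  refine Finset.sum_le_sum fun d hd => ?_
  have hdeg : ∑ i, d i ≤ k := by
    refine le_trans ?_ ((le_totalDegree hd).trans hp)
    rw [Finsupp.sum_fintype _ _ fun _ => rfl]
  have hprod : ∏ i, w i ^ d i ≤ (1 + ∑ i, w i) ^ k := calc
    ∏ i, w i ^ d i ≤ ∏ i, (1 + ∑ j, w j) ^ d i := by
      refine Finset.prod_le_prod (fun i _ => pow_nonneg (hw i) _) fun i _ => ?_
      have := Finset.single_le_sum (fun j _ => hw j) (Finset.mem_univ i)
      exact pow_le_pow_left₀ (hw i) (by linarith) _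
    _ = (1 + ∑ j, w j) ^ ∑ i, d i := Finset.prod_pow_eq_pow_sum _ _ _
    _ ≤ _ := pow_le_pow_right₀ (by linarith) hdeg
  exact mul_le_mul (le_abs_self _) hprod
    (Finset.prod_nonneg fun i _ => pow_nonneg (hw i) _) (abs_nonneg _)

open MvPolynomial in
/-- On the nonnegative orthant a polynomial with nonnegative coefficients dominates each of its
pure power terms. -/
theorem MvPolynomial.coeff_single_mul_pow_le_eval {σ : Type*} [Fintype σ]
    {p : MvPolynomial σ ℝ} (hp : ∀ d, 0 ≤ p.coeff d) {w : σ → ℝ} (hw : ∀ i, 0 ≤ w i)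
    (i : σ) (n : ℕ) : p.coeff (Finsupp.single i n) * w i ^ n ≤ eval w p := by
  classical
  have hterm : ∀ d ∈ p.support, 0 ≤ p.coeff d * ∏ j, w j ^ d j := fun d _ =>
    mul_nonneg (hp d) (Finset.prod_nonneg fun j _ => pow_nonneg (hw j) _)
  rw [eval_eq']
  by_cases hmem : Finsupp.single i n ∈ p.support
  · refine le_trans (le_of_eq ?_) (Finset.single_le_sum hterm hmem)
    rw [Finset.prod_eq_single i (fun j _ hj => by simp [Finsupp.single_eq_of_ne hj]) (by simp)]
    simp
  · rw [notMem_support_iff.mp hmem, zero_mul]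
    exact Finset.sum_nonneg hterm

open MvPolynomial in
/-- On the nonnegative orthant a polynomial with nonnegative coefficients whose pure `n`-th power
coefficients are positive grows at least like `(∑ i, w i) ^ n`. -/
theorem MvPolynomial.exists_pos_mul_sum_pow_le_eval {σ : Type*} [Fintype σ] [Nonempty σ]
    {n : ℕ} {p : MvPolynomial σ ℝ} (hp : ∀ d, 0 ≤ p.coeff d)
    (hpos : ∀ i, 0 < p.coeff (Finsupp.single i n)) :
    ∃ c : ℝ, 0 < c ∧ ∀ w : σ → ℝ, (∀ i, 0 ≤ w i) → c * (∑ i, w i) ^ n ≤ eval w p := by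
  obtain ⟨i₀, hi₀⟩ := Finite.exists_min fun i => p.coeff (Finsupp.single i n)
  have hcard : (0 : ℝ) < Fintype.card σ := by exact_mod_cast Fintype.card_pos
  refine ⟨p.coeff (Finsupp.single i₀ n) / (Fintype.card σ : ℝ) ^ n,
    div_pos (hpos i₀) (pow_pos hcard n), fun w hw => ?_⟩
  obtain ⟨i, hi⟩ := Finite.exists_max w
  have hsum : ∑ j, w j ≤ Fintype.card σ * w i := by
    simpa using Finset.sum_le_card_nsmul Finset.univ w (w i) fun j _ => hi j
  have hpow : (∑ j, w j) ^ n ≤ (Fintype.card σ : ℝ) ^ n * w i ^ n := by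
    rw [← mul_pow]
    exact pow_le_pow_left₀ (Finset.sum_nonneg fun j _ => hw j) hsum n
  calc p.coeff (Finsupp.single i₀ n) / (Fintype.card σ : ℝ) ^ n * (∑ j, w j) ^ n
      ≤ p.coeff (Finsupp.single i₀ n) / (Fintype.card σ : ℝ) ^ n *
          ((Fintype.card σ : ℝ) ^ n * w i ^ n) :=
        mul_le_mul_of_nonneg_left hpow (div_pos (hpos i₀) (pow_pos hcard n)).le
    _ = p.coeff (Finsupp.single i₀ n) * w i ^ n := by field_simp
    _ ≤ p.coeff (Finsupp.single i n) * w i ^ n :=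
        mul_le_mul_of_nonneg_right (hi₀ i) (pow_nonneg (hw i) n)
    _ ≤ eval w p := coeff_single_mul_pow_le_eval hp hw i n

/-- A positive multiple of `s ^ (k + 1)` eventually dominates any multiple of `(1 + s) ^ k`. -/
theorem exists_forall_ge_mul_one_add_pow_sub_mul_pow_le {A c : ℝ} (hA : 0 ≤ A) (hc : 0 < c)
    (k : ℕ) (M : ℝ) :
    ∃ R : ℝ, ∀ s, R ≤ s → A * (1 + s) ^ k - c * s ^ (k + 1) ≤ M := by
  refine ⟨max 1 ((A * 2 ^ k + |M|) / c), fun s hs => ?_⟩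
  have h1 : 1 ≤ s := (le_max_left _ _).trans hs
  have h2 : A * 2 ^ k + |M| ≤ s * c := (div_le_iff₀ hc).mp ((le_max_right _ _).trans hs)
  have h3 : (1 + s) ^ k ≤ 2 ^ k * s ^ k := by
    rw [← mul_pow]
    exact pow_le_pow_left₀ (by linarith) (by linarith) k
  have h4 : 1 ≤ s ^ k := one_le_pow₀ h1
  calc A * (1 + s) ^ k - c * s ^ (k + 1)
      ≤ A * (2 ^ k * s ^ k) - c * s ^ (k + 1) :=
        sub_le_sub_right (mul_le_mul_of_nonneg_left h3 hA) _
    _ = s ^ k * (A * 2 ^ k - s * c) := by ring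
    _ ≤ s ^ k * -|M| := mul_le_mul_of_nonneg_left (by linarith) (by linarith)
    _ ≤ -|M| := by nlinarith [abs_nonneg M]
    _ ≤ M := neg_abs_le M

theorem stmt16 (m n : ℕ) (hm : 1 ≤ m) (hn : 1 ≤ n)
    (Q P : MvPolynomial (Fin m) ℝ)
    (hQhom : Q.IsHomogeneous n)
    (hQpos : ∀ q : Fin m →₀ ℕ, (∑ j, q j) = n → 0 < Q.coeff q)
    (hP : P.totalDegree ≤ n - 1) :
    (∃ C : ℝ, ∀ w : Fin m → ℝ, (∀ i, 0 ≤ w i) →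
      MvPolynomial.eval w P - MvPolynomial.eval w Q ≤ C) ∧
    (∀ M : ℝ, ∃ R : ℝ, ∀ w : Fin m → ℝ, (∀ i, 0 ≤ w i) → R ≤ ∑ i, w i →
      MvPolynomial.eval w P - MvPolynomial.eval w Q ≤ M) := by
  have : Nonempty (Fin m) := ⟨⟨0, hm⟩⟩
  obtain ⟨k, rfl⟩ : ∃ k, n = k + 1 := ⟨n - 1, by omega⟩
  have hQnonneg : ∀ d, 0 ≤ Q.coeff d := fun d => by
    by_cases hd : d.degree = k + 1
    · exact (hQpos d (by rw [← hd, Finsupp.degree_eq_sum])).le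
    · exact (hQhom.coeff_eq_zero hd).ge
  obtain ⟨c, hc, hQ⟩ := MvPolynomial.exists_pos_mul_sum_pow_le_eval hQnonneg
    fun i => hQpos (Finsupp.single i (k + 1))
      (by rw [← Finsupp.degree_eq_sum, Finsupp.degree_single])
  have hPle := fun (w : Fin m → ℝ) hw =>
    MvPolynomial.eval_le_sum_abs_coeff_mul (k := k) (w := w) hP hw
  have hA : 0 ≤ ∑ d ∈ P.support, |P.coeff d| := Finset.sum_nonneg fun d _ => abs_nonneg _
  generalize (∑ d ∈ P.support, |P.coeff d|) = A at hPle hA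
  have hlim := exists_forall_ge_mul_one_add_pow_sub_mul_pow_le hA hc k
  refine ⟨?_, fun M => ?_⟩
  · obtain ⟨R, hR⟩ := hlim 0
    refine ⟨max 0 (A * (1 + R) ^ k), fun w hw => ?_⟩
    have hs : 0 ≤ ∑ i, w i := Finset.sum_nonneg fun i _ => hw i
    have hPw := hPle w hw
    have hQw := hQ w hw
    rcases le_total R (∑ i, w i) with h | h
    · have := hR _ h
      exact le_max_of_le_left (by linarith)
    · have hpow : A * (1 + ∑ i, w i) ^ k ≤ A * (1 + R) ^ k :=
        mul_le_mul_of_nonneg_left (pow_le_pow_left₀ (by linarith) (by linarith) k) hA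
      have : 0 ≤ c * (∑ i, w i) ^ (k + 1) := mul_nonneg hc.le (pow_nonneg hs _)
      exact le_max_of_le_right (by linarith)
  · obtain ⟨R, hR⟩ := hlim M
    refine ⟨R, fun w hw h => ?_⟩
    have := hR _ h
    have hPw := hPle w hw
    have hQw := hQ w hw
    linarith
end
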